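/- arXiv:1901.02859 — 6 statements merged into one kernel-verified Lean document; each statement's English description precedes it below -/
import Mathlib

section
/- Let a group G act on a set X, let 𝒟 be a G-lattice of subsets of X, let m be a mean on 𝒟, let W ∈ 𝒟 with m(W) > 0, and let n ≥ 1 be a natural number with n·m(W) > m(X). Then for any g₁, …, gₙ ∈ G there exist indices i < j such that m(g_j⁻¹g_i•W ∩ W) > 0; in particular St₁(W) = {g ∈ G : m(g•W ∩ W) > 0} is thick. -/
open Pointwise

/-- A subset `D` of a group `G` is thick if there is `n ≥ 1` such that among any
`g₁, …, gₙ ∈ G` there are `i < j` with `gⱼ⁻¹ * gᵢ ∈ D`. -/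
def IsThick {G : Type*} [Group G] (D : Set G) : Prop :=
  ∃ n : ℕ, 1 ≤ n ∧ ∀ g : Fin n → G, ∃ i j : Fin n, i < j ∧ (g j)⁻¹ * g i ∈ D

/-- A `G`-lattice of subsets of a `G`-set `X`: contains `∅` and `X`, closed under
translations, pairwise intersections and pairwise unions. -/
def IsGLattice (G : Type*) {X : Type*} [Group G] [MulAction G X] (D : Set (Set X)) : Prop :=
  ∅ ∈ D ∧ Set.univ ∈ D ∧ (∀ (g : G), ∀ Y ∈ D, g • Y ∈ D) ∧
    (∀ Y ∈ D, ∀ Z ∈ D, Y ∩ Z ∈ D) ∧ (∀ Y ∈ D, ∀ Z ∈ D, Y ∪ Z ∈ D)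

/-- A mean on a `G`-lattice: non-negative, monotone, translation-invariant, vanishing on `∅`,
and modular. -/
def IsMean (G : Type*) {X : Type*} [Group G] [MulAction G X] (D : Set (Set X))
    (m : Set X → ℝ) : Prop :=
  (∀ Y ∈ D, 0 ≤ m Y) ∧ (∀ Y ∈ D, ∀ Z ∈ D, Y ⊆ Z → m Y ≤ m Z) ∧
    (∀ (g : G), ∀ Y ∈ D, m (g • Y) = m Y) ∧ m ∅ = 0 ∧
    (∀ Y ∈ D, ∀ Z ∈ D, m (Y ∪ Z) = m Y + m Z - m (Y ∩ Z))

section Mean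

variable {G X : Type*} [Group G] [MulAction G X] {D : Set (Set X)} {m : Set X → ℝ}

theorem IsGLattice.biUnion_mem (hD : IsGLattice G D) {ι : Type*} (s : Finset ι) {A : ι → Set X}
    (hA : ∀ i ∈ s, A i ∈ D) : (⋃ i ∈ s, A i) ∈ D := by
  classical
  induction s using Finset.induction_on with
  | empty => simpa using hD.1
  | insert a s _ ih =>
    rw [Finset.set_biUnion_insert]
    exact hD.2.2.2.2 _ (hA a (Finset.mem_insert_self a s)) _
      (ih fun i hi => hA i (Finset.mem_insert_of_mem hi))

theorem IsMean.biUnion_le_sum (hD : IsGLattice G D) (hm : IsMean G D m) {ι : Type*}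
    (s : Finset ι) {A : ι → Set X} (hA : ∀ i ∈ s, A i ∈ D) :
    m (⋃ i ∈ s, A i) ≤ ∑ i ∈ s, m (A i) := by
  classical
  induction s using Finset.induction_on with
  | empty => simpa using hm.2.2.2.1.le
  | insert a s ha ih =>
    have hAs : ∀ i ∈ s, A i ∈ D := fun i hi => hA i (Finset.mem_insert_of_mem hi)
    have hAa := hA a (Finset.mem_insert_self a s)
    have hU := hD.biUnion_mem s hAs
    rw [Finset.set_biUnion_insert, Finset.sum_insert ha, hm.2.2.2.2 _ hAa _ hU]
    linarith [ih hAs, hm.1 _ (hD.2.2.2.1 _ hAa _ hU)]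

theorem IsMean.sum_le_biUnion (hD : IsGLattice G D) (hm : IsMean G D m) {ι : Type*}
    (s : Finset ι) {A : ι → Set X} (hA : ∀ i ∈ s, A i ∈ D)
    (hnull : ∀ i ∈ s, ∀ j ∈ s, i ≠ j → m (A i ∩ A j) ≤ 0) :
    ∑ i ∈ s, m (A i) ≤ m (⋃ i ∈ s, A i) := by
  classical
  induction s using Finset.induction_on with
  | empty => simpa using hm.2.2.2.1.ge
  | insert a s ha ih =>
    have hAs : ∀ i ∈ s, A i ∈ D := fun i hi => hA i (Finset.mem_insert_of_mem hi)
    have hAa := hA a (Finset.mem_insert_self a s)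
    have hinter : m (A a ∩ ⋃ i ∈ s, A i) ≤ 0 := by
      rw [Set.inter_iUnion₂]
      refine (hm.biUnion_le_sum hD s fun i hi => hD.2.2.2.1 _ hAa _ (hAs i hi)).trans
        (Finset.sum_nonpos fun i hi => ?_)
      exact hnull a (Finset.mem_insert_self a s) i (Finset.mem_insert_of_mem hi)
        (ne_of_mem_of_not_mem hi ha).symm
    rw [Finset.set_biUnion_insert, Finset.sum_insert ha,
      hm.2.2.2.2 _ hAa _ (hD.biUnion_mem s hAs)]
    linarith [ih hAs fun i hi j hj =>
      hnull i (Finset.mem_insert_of_mem hi) j (Finset.mem_insert_of_mem hj)]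

theorem IsMean.smul_inter_smul (hD : IsGLattice G D) (hm : IsMean G D m) {W : Set X}
    (hW : W ∈ D) (g h : G) : m (g • W ∩ h • W) = m ((h⁻¹ * g) • W ∩ W) := by
  rw [← hm.2.2.1 h _ (hD.2.2.2.1 _ (hD.2.2.1 _ W hW) W hW), Set.smul_set_inter, smul_smul,
    mul_inv_cancel_left]

theorem IsMean.exists_lt_pos_smul_inter (hD : IsGLattice G D) (hm : IsMean G D m) {W : Set X}
    (hW : W ∈ D) {n : ℕ} (hcov : m Set.univ < (n : ℝ) * m W) (g : Fin n → G) :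
    ∃ i j : Fin n, i < j ∧ 0 < m (((g j)⁻¹ * g i) • W ∩ W) := by
  by_contra! hnull
  have hmem : ∀ i ∈ (Finset.univ : Finset (Fin n)), g i • W ∈ D := fun i _ => hD.2.2.1 _ W hW
  have hsum := hm.sum_le_biUnion hD Finset.univ hmem fun i _ j _ hij => by
    rcases hij.lt_or_gt with h | h
    · exact (hm.smul_inter_smul hD hW _ _).trans_le (hnull i j h)
    · rw [Set.inter_comm]
      exact (hm.smul_inter_smul hD hW _ _).trans_le (hnull j i h)
  have huniv := hm.2.1 _ (hD.biUnion_mem Finset.univ hmem) _ hD.2.1 (Set.subset_univ _)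
  simp only [hm.2.2.1 _ W hW, Finset.sum_const, Finset.card_univ, Fintype.card_fin,
    nsmul_eq_mul] at hsum
  linarith

end Mean

/-- Lemma 2.7(1): if `m(W) > 0` and `n·m(W) > m(X)`, then among any `g₁, …, gₙ ∈ G`
there are `i < j` with `m(gⱼ⁻¹gᵢ • W ∩ W) > 0`; in particular
`St₁(W) = {g : m(g • W ∩ W) > 0}` is thick. -/
theorem st_one_thick {G X : Type*} [Group G] [MulAction G X]
    (D : Set (Set X)) (m : Set X → ℝ)
    (hD : IsGLattice G D) (hm : IsMean G D m)
    (W : Set X) (hW : W ∈ D) (hWpos : 0 < m W)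
    (n : ℕ) (hn : 1 ≤ n) (hcov : m Set.univ < (n : ℝ) * m W) :
    (∀ g : Fin n → G, ∃ i j : Fin n, i < j ∧ 0 < m (((g j)⁻¹ * g i) • W ∩ W)) ∧
      IsThick {g : G | 0 < m (g • W ∩ W)} := by
  have key := fun g => hm.exists_lt_pos_smul_inter hD hW hcov g
  exact ⟨key, n, hn, key⟩
end

section
/- Let a group G act on a set X, let 𝒟 be a G-lattice of subsets of X, let m be a mean on 𝒟, and let W ∈ 𝒟 with m(W) > 0. Then the generic-largeness condition L_k(W) holds for every k ∈ ℕ. -/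
open Pointwise

/-- A subset `D` of a group `G` is generic if finitely many left translates of `D` cover `G`. -/
def IsGeneric {G : Type*} [Group G] (D : Set G) : Prop :=
  ∃ F : Finset G, ∀ g : G, ∃ h ∈ F, h⁻¹ * g ∈ D

/-- The generic-largeness predicates `L_k`. -/
def LargeGen (G : Type*) {X : Type*} [Group G] [MulAction G X] : ℕ → Set X → Prop
  | 0, Y => Y.Nonempty
  | k + 1, Y => IsGeneric {g : G | LargeGen G k (g • Y ∩ Y)}

/-- If `{g | 0 < m (g • W ∩ W)}` is not generic, then for every `n` the lattice has a member `U` with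
`n * m W ≤ m U` whose null intersections are detected by finitely many translates of `W`. -/
theorem exists_mul_mean_le_of_not_isGeneric {G X : Type*} [Group G] [MulAction G X]
    {D : Set (Set X)} {m : Set X → ℝ} (hD : IsGLattice G D) (hm : IsMean G D m)
    {W : Set X} (hW : W ∈ D) (hgen : ¬ IsGeneric {g : G | 0 < m (g • W ∩ W)}) (n : ℕ) :
    ∃ F : Finset G, ∃ U ∈ D, n * m W ≤ m U ∧
      ∀ Z ∈ D, (∀ h ∈ F, m (Z ∩ h • W) = 0) → m (Z ∩ U) = 0 := by
  classical
  obtain ⟨hempty, -, hsmul, hinter, hunion⟩ := hD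
  obtain ⟨hnonneg, -, hinv, hzero, hmod⟩ := hm
  induction n with
  | zero => exact ⟨∅, ∅, hempty, by simp [hzero], fun Z _ _ => by simp [hzero]⟩
  | succ n ih =>
    obtain ⟨F, U, hU, hle, hnull⟩ := ih
    simp only [IsGeneric, Set.mem_ofPred_eq, not_exists, not_forall, not_and, not_lt] at hgen
    obtain ⟨g, hg⟩ := hgen F
    have hgW := hsmul g W hW
    have hgU : m (g • W ∩ U) = 0 := by
      refine hnull _ hgW fun h hh => ?_
      have heq : g • W ∩ h • W = h • ((h⁻¹ * g) • W ∩ W) := by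
        rw [Set.smul_set_inter, smul_smul, mul_inv_cancel_left]
      have hmem := hinter _ (hsmul (h⁻¹ * g) W hW) _ hW
      rw [heq, hinv _ _ hmem]
      exact le_antisymm (hg h hh) (hnonneg _ hmem)
    refine ⟨insert g F, g • W ∪ U, hunion _ hgW _ hU, ?_, fun Z hZ hZF => ?_⟩
    · rw [hmod _ hgW _ hU, hgU, hinv g W hW]
      push_cast
      linarith
    · have hZg : m (Z ∩ g • W) = 0 := hZF g (Finset.mem_insert_self g F)
      have hZU := hnull Z hZ fun h hh => hZF h (Finset.mem_insert_of_mem hh)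
      have hgmem := hinter _ hZ _ hgW
      have hUmem := hinter _ hZ _ hU
      have hsum := hmod _ hgmem _ hUmem
      have hinter_nonneg := hnonneg _ (hinter _ hgmem _ hUmem)
      have hunion_nonneg := hnonneg _ (hunion _ hgmem _ hUmem)
      rw [Set.inter_union_distrib_left]
      linarith

theorem isGeneric_mean_smul_inter_pos {G X : Type*} [Group G] [MulAction G X]
    {D : Set (Set X)} {m : Set X → ℝ} (hD : IsGLattice G D) (hm : IsMean G D m)
    {W : Set X} (hW : W ∈ D) (hWpos : 0 < m W) :
    IsGeneric {g : G | 0 < m (g • W ∩ W)} := by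
  by_contra hgen
  obtain ⟨n, hn⟩ := exists_nat_gt (m Set.univ / m W)
  obtain ⟨-, U, hU, hle, -⟩ := exists_mul_mean_le_of_not_isGeneric hD hm hW hgen n
  have hUle := hm.2.1 U hU Set.univ hD.2.1 (Set.subset_univ U)
  rw [div_lt_iff₀ hWpos] at hn
  linarith

theorem IsGeneric.mono {G : Type*} [Group G] {A B : Set G} (hA : IsGeneric A) (hAB : A ⊆ B) :
    IsGeneric B := by
  obtain ⟨F, hF⟩ := hA
  refine ⟨F, fun g => ?_⟩
  obtain ⟨h, hh, hmem⟩ := hF g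
  exact ⟨h, hh, hAB hmem⟩

/-- Lemma 2.7(2), generic variant: if `m` is a mean on a `G`-lattice `D` and `W ∈ D` has
positive mean, then `L_k(W)` holds for all `k`. -/
theorem largeGen_of_mean_pos {G X : Type*} [Group G] [MulAction G X]
    (D : Set (Set X)) (m : Set X → ℝ)
    (hD : IsGLattice G D) (hm : IsMean G D m)
    (W : Set X) (hW : W ∈ D) (hWpos : 0 < m W) :
    ∀ k : ℕ, LargeGen G k W := by
  intro k
  induction k generalizing W with
  | zero =>
    refine Set.nonempty_iff_ne_empty.mpr fun hempty => ?_
    rw [hempty, hm.2.2.2.1] at hWpos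
    exact lt_irrefl 0 hWpos
  | succ k ih =>
    exact (isGeneric_mean_smul_inter_pos hD hm hW hWpos).mono fun g hg =>
      ih (g • W ∩ W) (hD.2.2.2.1 _ (hD.2.2.1 g W hW) W hW) hg
end

section
/- Let a group G act on a set X, let 𝒟 be a G-lattice of subsets of X, let m be a mean on 𝒟, and let Z ∈ 𝒟. Then for all real numbers ε₁ and ε₂, St_{ε₁}(Z)·St_{ε₂}(Z) ⊆ St_{ε₁+ε₂}(Z); that is, if m(g₁•Z ∩ Z) > (1 − ε₁)·m(Z) and m(g₂•Z ∩ Z) > (1 − ε₂)·m(Z), then m(g₁g₂•Z ∩ Z) > (1 − (ε₁ + ε₂))·m(Z). -/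
open Pointwise

/-- Lemma 2.9: `St_{ε₁}(Z) · St_{ε₂}(Z) ⊆ St_{ε₁+ε₂}(Z)`, where
`St_ε(Z) = {g : m(g • Z ∩ Z) > (1 - ε)·m(Z)}`. -/
theorem stabilizer_mul_subset {G X : Type*} [Group G] [MulAction G X]
    (D : Set (Set X)) (m : Set X → ℝ)
    (hD : IsGLattice G D) (hm : IsMean G D m)
    (Z : Set X) (hZ : Z ∈ D) :
    ∀ ε₁ ε₂ : ℝ, ∀ g₁ g₂ : G,
      (1 - ε₁) * m Z < m (g₁ • Z ∩ Z) →
      (1 - ε₂) * m Z < m (g₂ • Z ∩ Z) →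
      (1 - (ε₁ + ε₂)) * m Z < m ((g₁ * g₂) • Z ∩ Z) := by
  obtain ⟨-, -, smul_mem, inter_mem, union_mem⟩ := hD
  obtain ⟨-, mono, inv, -, modular⟩ := hm
  intro ε₁ ε₂ g₁ g₂ h₁ h₂
  have hg₁ := smul_mem g₁ Z hZ
  have hA := inter_mem _ hg₁ _ hZ
  have hW := inter_mem _ (smul_mem g₂ Z hZ) _ hZ
  have hB := smul_mem g₁ _ hW
  have smul_inter : g₁ • (g₂ • Z ∩ Z) = (g₁ * g₂) • Z ∩ g₁ • Z := by
    rw [Set.smul_set_inter, smul_smul]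
  have union_le := mono _ (union_mem _ hA _ hB) _ hg₁
    (Set.union_subset Set.inter_subset_left (smul_inter ▸ Set.inter_subset_right))
  have inter_le := mono _ (inter_mem _ hA _ hB) _
    (inter_mem _ (smul_mem (g₁ * g₂) Z hZ) _ hZ)
    (fun x hx => ⟨(smul_inter ▸ hx.2 : x ∈ (g₁ * g₂) • Z ∩ g₁ • Z).1, hx.1.2⟩)
  rw [modular _ hA _ hB, inv g₁ Z hZ, inv g₁ _ hW] at union_le
  linarith
end

section
/- Let L be a lattice of subsets of a set X (a family containing ∅ and X and closed under pairwise intersections and unions) and let ρ be a normalized mean on L, i.e. ρ : L → ℝ is monotone, takes values in [0,1], satisfies ρ(∅) = 0, ρ(X) = 1, and is modular: ρ(Y ∪ Z) = ρ(Y) + ρ(Z) − ρ(Y ∩ Z) for all Y, Z ∈ L. Let B(L) be the Boolean algebra of subsets of X generated by L (the smallest family of subsets containing L and closed under complements in X and pairwise unions). Then ρ extends to a finitely additive content on B(L): there exists ν : B(L) → ℝ with ν ≥ 0, ν(∅) = 0, ν restricted to L equal to ρ, and ν(Y ∪ Z) = ν(Y) + ν(Z) for all disjoint Y, Z ∈ B(L);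 moreover this extension is unique, and if a group G acts on X so that L is closed under the translations Y ↦ g•Y and ρ is translation-invariant (ρ(g•Y) = ρ(Y)), then ν is translation-invariant as well. -/
open Pointwise

/-- The Boolean algebra of subsets of `X` generated by a family `L`: the smallest family
containing `L` and closed under complements and pairwise unions. -/
inductive BoolGen {X : Type*} (L : Set (Set X)) : Set X → Prop
  | base : ∀ Y ∈ L, BoolGen L Y
  | compl : ∀ {Y : Set X}, BoolGen L Y → BoolGen L Yᶜ
  | union : ∀ {Y Z : Set X}, BoolGen L Y → BoolGen L Z → BoolGen L (Y ∪ Z)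

/-- `ρ` is a monotone modular function, vanishing at `∅`, on the lattice of sets `L`. -/
structure IsSetMean {X : Type*} (L : Set (Set X)) (ρ : Set X → ℝ) : Prop where
  empty_mem : ∅ ∈ L
  univ_mem : Set.univ ∈ L
  inter_mem : ∀ Y ∈ L, ∀ Z ∈ L, Y ∩ Z ∈ L
  union_mem : ∀ Y ∈ L, ∀ Z ∈ L, Y ∪ Z ∈ L
  mono : ∀ Y ∈ L, ∀ Z ∈ L, Y ⊆ Z → ρ Y ≤ ρ Z
  empty : ρ ∅ = 0
  modular : ∀ Y ∈ L, ∀ Z ∈ L, ρ (Y ∪ Z) = ρ Y + ρ Z - ρ (Y ∩ Z)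

/-- The number of members of the list `l` containing a given point. -/
noncomputable def setCount {X : Type*} (l : List (Set X)) : X → ℤ :=
  (l.map fun A => A.indicator (1 : X → ℤ)).sum

/-- The set of points lying in at least `k` members of the list `l`. -/
def setLevel {X : Type*} (l : List (Set X)) (k : ℕ) : Set X := {x | (k : ℤ) ≤ setCount l x}

section SetCount

variable {X : Type*}

@[simp] lemma setCount_nil : setCount ([] : List (Set X)) = 0 := rfl

@[simp] lemma setCount_cons (A : Set X) (l : List (Set X)) :
    setCount (A :: l) = A.indicator 1 + setCount l := by
  simp [setCount]

@[simp] lemma setCount_append (l m : List (Set X)) :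
    setCount (l ++ m) = setCount l + setCount m := by
  simp [setCount]

lemma setCount_nonneg (l : List (Set X)) (x : X) : 0 ≤ setCount l x := by
  induction l with
  | nil => simp
  | cons A l ih =>
    by_cases h : x ∈ A <;> simp [h] <;> omega

lemma setCount_le_length (l : List (Set X)) (x : X) : setCount l x ≤ l.length := by
  induction l with
  | nil => simp
  | cons A l ih =>
    by_cases h : x ∈ A <;> simp [h] <;> omega

lemma setLevel_zero (l : List (Set X)) : setLevel l 0 = Set.univ := by
  ext x
  simpa [setLevel] using setCount_nonneg l x

lemma setLevel_eq_empty {l : List (Set X)} {k : ℕ} (hk : l.length < k) : setLevel l k = ∅ := by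
  ext x
  have := setCount_le_length l x
  simp only [setLevel, Set.mem_ofPred_eq, Set.mem_empty_iff_false, iff_false]
  omega

lemma setLevel_cons_succ (A : Set X) (l : List (Set X)) (k : ℕ) :
    setLevel (A :: l) (k + 1) = setLevel l (k + 1) ∪ A ∩ setLevel l k := by
  ext x
  by_cases h : x ∈ A
  · simp [setLevel, h]
    omega
  · simp [setLevel, h]

lemma setLevel_succ_subset (l : List (Set X)) (k : ℕ) : setLevel l (k + 1) ⊆ setLevel l k := by
  intro x hx
  simp only [setLevel, Set.mem_ofPred_eq] at *
  omega

end SetCount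

namespace IsSetMean

variable {X : Type*} {L : Set (Set X)} {ρ : Set X → ℝ}

lemma setLevel_mem (h : IsSetMean L ρ) {l : List (Set X)} (hl : ∀ A ∈ l, A ∈ L) (k : ℕ) :
    setLevel l k ∈ L := by
  induction l generalizing k with
  | nil =>
    cases k with
    | zero => rw [setLevel_zero]; exact h.univ_mem
    | succ k => rw [setLevel_eq_empty (by simp)]; exact h.empty_mem
  | cons A l ih =>
    have hl' : ∀ B ∈ l, B ∈ L := fun B hB => hl B (by simp [hB])
    cases k with
    | zero => rw [setLevel_zero]; exact h.univ_mem
    | succ k =>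
      rw [setLevel_cons_succ]
      exact h.union_mem _ (ih hl' _) _ (h.inter_mem _ (hl A (by simp)) _ (ih hl' _))

/-- Layer-cake formula: a sum of values of `ρ` may be computed on the level sets. -/
lemma sum_setLevel (h : IsSetMean L ρ) {l : List (Set X)} (hl : ∀ A ∈ l, A ∈ L) {n : ℕ}
    (hn : l.length ≤ n) :
    ∑ k ∈ Finset.range n, ρ (setLevel l (k + 1)) = (l.map ρ).sum := by
  induction l with
  | nil => simp [setLevel_eq_empty, h.empty]
  | cons A l ih =>
    have hl' : ∀ B ∈ l, B ∈ L := fun B hB => hl B (by simp [hB])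
    have hA : A ∈ L := hl A (by simp)
    rw [List.length_cons] at hn
    have step (k : ℕ) : ρ (setLevel (A :: l) (k + 1)) = ρ (setLevel l (k + 1)) +
        (ρ (A ∩ setLevel l k) - ρ (A ∩ setLevel l (k + 1))) := by
      have hinter : setLevel l (k + 1) ∩ (A ∩ setLevel l k) = A ∩ setLevel l (k + 1) := by
        rw [Set.inter_left_comm, Set.inter_eq_left.2 (setLevel_succ_subset l k)]
      rw [setLevel_cons_succ, h.modular _ (h.setLevel_mem hl' _) _
        (h.inter_mem _ hA _ (h.setLevel_mem hl' _)), hinter]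
      ring
    simp only [step]
    rw [Finset.sum_add_distrib, ih hl' (by omega),
      Finset.sum_range_sub' fun k => ρ (A ∩ setLevel l k), setLevel_zero,
      setLevel_eq_empty (by omega)]
    simp [h.empty, add_comm]

lemma sum_le_sum (h : IsSetMean L ρ) {l m : List (Set X)} (hl : ∀ A ∈ l, A ∈ L)
    (hm : ∀ A ∈ m, A ∈ L) (hlm : setCount l ≤ setCount m) : (l.map ρ).sum ≤ (m.map ρ).sum := by
  rw [← h.sum_setLevel hl (le_max_left _ m.length), ← h.sum_setLevel hm (le_max_right l.length _)]
  exact Finset.sum_le_sum fun k _ => h.mono _ (h.setLevel_mem hl _) _ (h.setLevel_mem hm _)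
    fun x hx => le_trans hx (hlm x)

lemma sum_eq_sum (h : IsSetMean L ρ) {l m : List (Set X)} (hl : ∀ A ∈ l, A ∈ L)
    (hm : ∀ A ∈ m, A ∈ L) (hlm : setCount l = setCount m) : (l.map ρ).sum = (m.map ρ).sum :=
  le_antisymm (h.sum_le_sum hl hm hlm.le) (h.sum_le_sum hm hl hlm.ge)

end IsSetMean

namespace BoolGen

variable {X : Type*} {L : Set (Set X)}

lemma inter {Y Z : Set X} (hY : BoolGen L Y) (hZ : BoolGen L Z) : BoolGen L (Y ∩ Z) := by
  simpa [Set.compl_union] using (hY.compl.union hZ.compl).compl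

lemma sdiff {Y Z : Set X} (hY : BoolGen L Y) (hZ : BoolGen L Z) : BoolGen L (Y \ Z) :=
  hY.inter hZ.compl

lemma smul {G : Type*} [Group G] [MulAction G X] {g : G} (hg : ∀ Y ∈ L, g • Y ∈ L) {Y : Set X}
    (hY : BoolGen L Y) : BoolGen L (g • Y) := by
  induction hY with
  | base Y hY => exact .base _ (hg Y hY)
  | compl _ ih => rw [Set.smul_set_compl]; exact ih.compl
  | union _ _ ihY ihZ => rw [Set.smul_set_union]; exact ihY.union ihZ

lemma indicator_mem_closure {Y : Set X} (hY : BoolGen L Y) :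
    Y.indicator (1 : X → ℤ) ∈
      Subring.closure ((fun A : Set X => A.indicator (1 : X → ℤ)) '' L) := by
  induction hY with
  | base Y hY => exact Subring.subset_closure ⟨Y, hY, rfl⟩
  | compl _ ih => rw [Set.indicator_compl]; exact sub_mem (one_mem _) ih
  | @union Y Z _ _ ihY ihZ =>
    have : (Y ∪ Z).indicator (1 : X → ℤ) =
        Y.indicator 1 + Z.indicator 1 - Y.indicator 1 * Z.indicator 1 := by
      ext x
      by_cases hY : x ∈ Y <;> by_cases hZ : x ∈ Z <;> simp [hY, hZ]
    rw [this]
    exact sub_mem (add_mem ihY ihZ) (mul_mem ihY ihZ)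

/-- The indicator of a set in the generated Boolean algebra is an integer combination of
indicators of sets in the lattice. -/
lemma exists_setCount (huniv : Set.univ ∈ L) (hinter : ∀ Y ∈ L, ∀ Z ∈ L, Y ∩ Z ∈ L)
    {Y : Set X} (hY : BoolGen L Y) :
    ∃ P N : List (Set X), (∀ A ∈ P, A ∈ L) ∧ (∀ A ∈ N, A ∈ L) ∧
      Y.indicator 1 + setCount N = setCount P := by
  let M : Submonoid (X → ℤ) :=
    { carrier := (fun A : Set X => A.indicator (1 : X → ℤ)) '' L
      one_mem' := ⟨Set.univ, huniv, by simp⟩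
      mul_mem' := by
        rintro _ _ ⟨A, hA, rfl⟩ ⟨B, hB, rfl⟩
        exact ⟨A ∩ B, hinter A hA B hB, Set.inter_indicator_one⟩ }
  have hmem := Subring.mem_closure_iff.1 hY.indicator_mem_closure
  have hM : Submonoid.closure ((fun A : Set X => A.indicator (1 : X → ℤ)) '' L) = M :=
    Submonoid.closure_eq M
  rw [hM] at hmem
  generalize Y.indicator (1 : X → ℤ) = f at hmem ⊢
  induction hmem using AddSubgroup.closure_induction with
  | mem f hf =>
    obtain ⟨A, hA, rfl⟩ := hf
    exact ⟨[A], [], by simpa using hA, by simp, by simp⟩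
  | zero => exact ⟨[], [], by simp, by simp, by simp⟩
  | add f g _ _ hf hg =>
    obtain ⟨P, N, hP, hN, h⟩ := hf
    obtain ⟨Q, M, hQ, hM, h'⟩ := hg
    refine ⟨P ++ Q, N ++ M, List.forall_mem_append.2 ⟨hP, hQ⟩,
      List.forall_mem_append.2 ⟨hN, hM⟩, ?_⟩
    rw [setCount_append, setCount_append, ← h, ← h']
    abel
  | neg f _ hf =>
    obtain ⟨P, N, hP, hN, h⟩ := hf
    exact ⟨N, P, hN, hP, by rw [← h]; abel⟩

/-- A content on the generated Boolean algebra is monotone and modular. -/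
lemma isSetMean {ν : Set X → ℝ} (hempty : ∅ ∈ L) (huniv : Set.univ ∈ L)
    (hnonneg : ∀ Y, BoolGen L Y → 0 ≤ ν Y) (hν : ν ∅ = 0)
    (hadd : ∀ Y Z : Set X, BoolGen L Y → BoolGen L Z → Y ∩ Z = ∅ → ν (Y ∪ Z) = ν Y + ν Z) :
    IsSetMean {Y | BoolGen L Y} ν where
  empty_mem := .base _ hempty
  univ_mem := .base _ huniv
  inter_mem _ hY _ hZ := hY.inter hZ
  union_mem _ hY _ hZ := hY.union hZ
  mono Y hY Z hZ hYZ := by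
    have h := hadd Y (Z \ Y) hY (sdiff hZ hY) (Set.inter_sdiff_self _ _)
    rw [Set.union_sdiff_cancel hYZ] at h
    linarith [hnonneg _ (sdiff hZ hY)]
  empty := hν
  modular Y hY Z hZ := by
    have h₁ := hadd Y (Z \ Y) hY (sdiff hZ hY) (Set.inter_sdiff_self _ _)
    have h₂ := hadd (Y ∩ Z) (Z \ Y) (inter hY hZ) (sdiff hZ hY) (by ext; simp; tauto)
    rw [Set.union_sdiff_self] at h₁
    rw [show Y ∩ Z ∪ Z \ Y = Z by ext; simp; tauto] at h₂
    linarith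

end BoolGen

/-- Proposition 2.18: a normalized mean `ρ` on a lattice `L` of subsets of `X` extends
uniquely to a finitely additive content `ν` on the Boolean algebra generated by `L`;
moreover, if a group `G` acts on `X` leaving `L` and `ρ` invariant, then `ν` is invariant. -/
theorem mean_extends_uniquely_to_content {X : Type*} (G : Type*) [Group G] [MulAction G X]
    (L : Set (Set X))
    (hempty : ∅ ∈ L) (huniv : Set.univ ∈ L)
    (hinter : ∀ Y ∈ L, ∀ Z ∈ L, Y ∩ Z ∈ L) (hunion : ∀ Y ∈ L, ∀ Z ∈ L, Y ∪ Z ∈ L)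
    (ρ : Set X → ℝ)
    (hmono : ∀ Y ∈ L, ∀ Z ∈ L, Y ⊆ Z → ρ Y ≤ ρ Z)
    (hrange : ∀ Y ∈ L, 0 ≤ ρ Y ∧ ρ Y ≤ 1)
    (hρempty : ρ ∅ = 0) (hρuniv : ρ Set.univ = 1)
    (hmod : ∀ Y ∈ L, ∀ Z ∈ L, ρ (Y ∪ Z) = ρ Y + ρ Z - ρ (Y ∩ Z)) :
    ∃ ν : Set X → ℝ,
      ((∀ Y, BoolGen L Y → 0 ≤ ν Y) ∧ ν ∅ = 0 ∧ (∀ Y ∈ L, ν Y = ρ Y) ∧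
        (∀ Y Z : Set X, BoolGen L Y → BoolGen L Z → Y ∩ Z = ∅ → ν (Y ∪ Z) = ν Y + ν Z)) ∧
      (∀ ν' : Set X → ℝ,
        ((∀ Y, BoolGen L Y → 0 ≤ ν' Y) ∧ ν' ∅ = 0 ∧ (∀ Y ∈ L, ν' Y = ρ Y) ∧
          (∀ Y Z : Set X, BoolGen L Y → BoolGen L Z → Y ∩ Z = ∅ →
            ν' (Y ∪ Z) = ν' Y + ν' Z)) →
        ∀ Y, BoolGen L Y → ν' Y = ν Y) ∧
      ((∀ (g : G), ∀ Y ∈ L, g • Y ∈ L) → (∀ (g : G), ∀ Y ∈ L, ρ (g • Y) = ρ Y) →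
        ∀ (g : G), ∀ Y, BoolGen L Y → ν (g • Y) = ν Y) := by
  have hρ : IsSetMean L ρ := ⟨hempty, huniv, hinter, hunion, hmono, hρempty, hmod⟩
  have hrep (Y : Set X) : ∃ P N : List (Set X), BoolGen L Y →
      (∀ A ∈ P, A ∈ L) ∧ (∀ A ∈ N, A ∈ L) ∧ Y.indicator 1 + setCount N = setCount P := by
    by_cases hY : BoolGen L Y
    · obtain ⟨P, N, h⟩ := hY.exists_setCount huniv hinter
      exact ⟨P, N, fun _ => h⟩
    · exact ⟨[], [], fun h => absurd h hY⟩
  choose P N hPN using hrep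
  let ν : Set X → ℝ := fun Y => ((P Y).map ρ).sum - ((N Y).map ρ).sum
  have hνρ : ∀ Y ∈ L, ν Y = ρ Y := by
    intro Y hY
    obtain ⟨hP, hN, h⟩ := hPN Y (.base Y hY)
    have := hρ.sum_eq_sum (l := Y :: N Y) (List.forall_mem_cons.2 ⟨hY, hN⟩) hP (by simpa using h)
    rw [List.map_cons, List.sum_cons] at this
    simp only [ν]
    linarith
  have hν0 : ∀ Y, BoolGen L Y → 0 ≤ ν Y := by
    intro Y hY
    obtain ⟨hP, hN, h⟩ := hPN Y hY
    refine sub_nonneg.2 (hρ.sum_le_sum hN hP ?_)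
    rw [← h]
    exact le_add_of_nonneg_left (Set.indicator_nonneg fun _ _ => zero_le_one)
  have hνempty : ν ∅ = 0 := (hνρ ∅ hempty).trans hρempty
  have hνadd : ∀ Y Z : Set X, BoolGen L Y → BoolGen L Z → Y ∩ Z = ∅ →
      ν (Y ∪ Z) = ν Y + ν Z := by
    intro Y Z hY hZ hYZ
    obtain ⟨hP₁, hN₁, h₁⟩ := hPN Y hY
    obtain ⟨hP₂, hN₂, h₂⟩ := hPN Z hZ
    obtain ⟨hP, hN, h⟩ := hPN _ (hY.union hZ)
    have := hρ.sum_eq_sum (l := P (Y ∪ Z) ++ (N Y ++ N Z)) (m := N (Y ∪ Z) ++ (P Y ++ P Z))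
      (by simp only [List.forall_mem_append]; exact ⟨hP, hN₁, hN₂⟩)
      (by simp only [List.forall_mem_append]; exact ⟨hN, hP₁, hP₂⟩) (by
        simp only [setCount_append, ← h, ← h₁, ← h₂,
          Set.indicator_union_of_disjoint (Set.disjoint_iff_inter_eq_empty.2 hYZ)]
        ext x
        simp only [Pi.add_apply]
        ring)
    simp only [List.map_append, List.sum_append] at this
    simp only [ν]
    linarith
  have hunique : ∀ ν' : Set X → ℝ,
      ((∀ Y, BoolGen L Y → 0 ≤ ν' Y) ∧ ν' ∅ = 0 ∧ (∀ Y ∈ L, ν' Y = ρ Y) ∧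
        (∀ Y Z : Set X, BoolGen L Y → BoolGen L Z → Y ∩ Z = ∅ → ν' (Y ∪ Z) = ν' Y + ν' Z)) →
      ∀ Y, BoolGen L Y → ν' Y = ν Y := by
    rintro ν' ⟨h0, he, hext, hadd⟩ Y hY
    obtain ⟨hP, hN, h⟩ := hPN Y hY
    have := (BoolGen.isSetMean hempty huniv h0 he hadd).sum_eq_sum (l := Y :: N Y) (m := P Y)
      (List.forall_mem_cons.2 ⟨hY, fun A hA => .base A (hN A hA)⟩)
      (fun A hA => .base A (hP A hA)) (by simpa using h)
    rw [List.map_cons, List.sum_cons, List.map_congr_left fun A hA => hext A (hN A hA),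
      List.map_congr_left fun A hA => hext A (hP A hA)] at this
    simp only [ν]
    linarith
  refine ⟨ν, ⟨hν0, hνempty, hνρ, hνadd⟩, hunique, fun hL hinv g => ?_⟩
  refine hunique (fun Y => ν (g • Y)) ⟨fun Y hY => hν0 _ (hY.smul (hL g)), ?_, fun Y hY => ?_,
    fun Y Z hY hZ hYZ => ?_⟩
  · simpa using hνempty
  · exact (hνρ _ (hL g Y hY)).trans (hinv g Y hY)
  · simp only [Set.smul_set_union]
    exact hνadd _ _ (hY.smul (hL g)) (hZ.smul (hL g))
      (by rw [← Set.smul_set_inter, hYZ, Set.smul_set_empty])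
end

section
/- Let a group Γ act on a set S, let a ∈ S, let n ≥ 2, and let Y₁, …, Yₙ be subsets of S. For Y ⊆ S put A_Y := {σ ∈ Γ : σ•a ∈ Y}, and for pairs write (u, v) ≈ (u′, v′) iff there exists τ ∈ Γ with τ•u′ = u and τ•v′ = v (i.e. the pairs lie in the same orbit of the diagonal action of Γ on S × S). Then the product set A_{Y₁}·A_{Y₂}·…·A_{Yₙ} consists exactly of those σ ∈ Γ for which there exist b₁ ∈ Y₁, …, bₙ ∈ Yₙ and z₁, …, z_{n−2} ∈ S such that (σ•a, z_{n−2}) ≈ (bₙ, a), (z_{j+1}, z_j) ≈ (b_{j+2}, a) for all 1 ≤ j ≤ n−3, and (z₁, b₁) ≈ (b₂, a); in the case n = 2 the condition reads: there exist b₁ ∈ Y₁ and b₂ ∈ Y₂ with (σ•a, b₁) ≈ (b₂, a). -/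
open Pointwise

/-- An element lies in a product of `n` subsets of a group iff it is the end of a path of partial
products starting at `1` whose successive quotients lie in the respective subsets. -/
theorem Set.mem_prod_list_ofFn_iff_exists_path {G : Type*} [Group G] {n : ℕ}
    (s : Fin n → Set G) (x : G) :
    x ∈ (List.ofFn s).prod ↔
      ∃ g : Fin (n + 1) → G, g 0 = 1 ∧ g (Fin.last n) = x ∧
        ∀ i : Fin n, (g i.castSucc)⁻¹ * g i.succ ∈ s i := by
  have prod_eq (f : Fin n → G) : Fin.partialProd f (Fin.last n) = (List.ofFn f).prod := by
    simp [Fin.partialProd, List.take_of_length_le]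
  rw [Set.mem_prod_list_ofFn]
  constructor
  · rintro ⟨f, rfl⟩
    refine ⟨Fin.partialProd fun i => (f i : G), Fin.partialProd_zero _, prod_eq _, fun i => ?_⟩
    rw [Fin.partialProd_right_inv]
    exact (f i).2
  · rintro ⟨g, hg0, rfl, hg⟩
    refine ⟨fun i => ⟨_, hg i⟩, ?_⟩
    rw [← prod_eq]
    simpa [hg0] using congrFun (Fin.partialProd_left_inv g) (Fin.last n)

/-- Lemma 4.29(ii) (semantic/orbit form): for a group `Γ` acting on a set `S`, `a ∈ S`,
`n ≥ 2` and subsets `Y₁, …, Yₙ` of `S`, the product `A_{Y₁}·…·A_{Yₙ}` of the sets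
`A_Y = {σ : σ•a ∈ Y}` consists exactly of those `σ` for which there are `b i ∈ Y i`
and a chain `z` with `z 0 = b 0`, `z (n-1) = σ•a`, and each consecutive pair
`(z (j+1), z j)` lying in the same diagonal `Γ`-orbit as `(b (j+1), a)`.
(Here `(u, v) ≈ (u', v')` iff `∃ τ, τ•u' = u ∧ τ•v' = v`; unfolding the chain for
`z 0 = b 0` and `z (n-1) = σ•a` recovers the conditions
`(σ•a, z_{n-2}) ≈ (bₙ, a)`, `(z_{j+1}, z_j) ≈ (b_{j+2}, a)`, `(z₁, b₁) ≈ (b₂, a)`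
of the paper, and for `n = 2` the condition `(σ•a, b₁) ≈ (b₂, a)`.) -/
theorem product_of_relative_orbit_sets {Γ S : Type*} [Group Γ] [MulAction Γ S]
    (a : S) (n : ℕ) (hn : 2 ≤ n) (Y : Fin n → Set S) :
    (List.ofFn (fun i : Fin n => {σ : Γ | σ • a ∈ Y i})).prod =
      {σ : Γ | ∃ b : Fin n → S, (∀ i, b i ∈ Y i) ∧
        ∃ z : Fin n → S,
          z ⟨0, by omega⟩ = b ⟨0, by omega⟩ ∧
          z ⟨n - 1, by omega⟩ = σ • a ∧
          ∀ j : Fin (n - 1),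
            ∃ τ : Γ,
              τ • b ⟨j.val + 1, by have := j.isLt; omega⟩ =
                z ⟨j.val + 1, by have := j.isLt; omega⟩ ∧
              τ • a = z ⟨j.val, by have := j.isLt; omega⟩} := by
  obtain ⟨m, rfl⟩ : ∃ m, n = m + 1 := ⟨n - 1, by omega⟩
  ext σ
  rw [Set.mem_prod_list_ofFn_iff_exists_path, Set.mem_ofPred_eq]
  constructor
  · rintro ⟨g, hg0, hgl, hg⟩
    refine ⟨fun i => ((g i.castSucc)⁻¹ * g i.succ) • a, hg, fun i => g i.succ • a, ?_, ?_,
      fun j => ⟨g ⟨j + 1, by omega⟩, ?_, rfl⟩⟩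
    · change g 1 • a = ((g 0)⁻¹ * g 1) • a
      simp [hg0]
    · rw [← hgl]
      rfl
    · rw [smul_smul]
      exact congrArg (· • a) (mul_inv_cancel_left (g ⟨j + 1, by omega⟩) _)
  · rintro ⟨b, hb, z, hz0, hzl, hz⟩
    choose τ hτb hτa using hz
    let g : Fin (m + 2) → Γ := Fin.cons 1 (Fin.snoc (α := fun _ => Γ) τ σ)
    have hga (i : Fin (m + 1)) : g i.succ • a = z i := by
      induction i using Fin.lastCases with
      | last =>
        simp only [g, Fin.cons_succ, Fin.snoc_last]
        exact hzl.symm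
      | cast j =>
        simp only [g, Fin.cons_succ, Fin.snoc_castSucc]
        exact hτa j
    have hgb (i : Fin (m + 1)) : g i.castSucc • b i = z i := by
      induction i using Fin.cases with
      | zero => simpa [g] using hz0.symm
      | succ j =>
        simp only [g, ← Fin.succ_castSucc, Fin.cons_succ, Fin.snoc_castSucc]
        exact hτb j
    refine ⟨g, rfl, by simp [g, ← Fin.succ_last], fun i => ?_⟩
    rw [Set.mem_ofPred_eq, mul_smul, hga, ← hgb, inv_smul_smul]
    exact hb i
end

section
/- Let X = ℕ, for each n let X_n = {0, 1, …, n}, and let L = {∅, ℕ} ∪ {X_n : n ∈ ℕ}. Define ρ on L by ρ(∅) = 0, ρ(ℕ) = 1, and ρ(X_n) = 1/2 for every n. Then: (a) L is a lattice of subsets of ℕ (containing ∅ and ℕ and closed under pairwise intersections and unions) and ρ is a normalized mean on L; (b) every decreasing sequence of members of L with empty intersection is eventually equal to ∅ (so ρ is continuous at ∅ along L); but (c) any finitely additive non-negative extension ν of ρ to the Boolean algebra of subsets of ℕ generated by L satisfies ν(ℕ \ X_n) = 1/2 for every n, even though the sets ℕ \ X_n decrease with empty intersection; in particular ν is not continuous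 at ∅ and hence is not a pre-measure (σ-additivity fails). -/
/-- The chain of subsets of `ℕ` made of `∅`, `ℕ` and all initial segments is totally ordered. -/
theorem subset_total_of_mem_chain {Y Z : Set ℕ}
    (hY : Y = ∅ ∨ Y = Set.univ ∨ ∃ n : ℕ, Y = Set.Iic n)
    (hZ : Z = ∅ ∨ Z = Set.univ ∨ ∃ n : ℕ, Z = Set.Iic n) : Y ⊆ Z ∨ Z ⊆ Y := by
  rcases hY with rfl | rfl | ⟨m, rfl⟩
  · simp
  · simp
  · rcases hZ with rfl | rfl | ⟨n, rfl⟩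
    · simp
    · simp
    · simpa only [Set.Iic_subset_Iic] using le_total m n

/-- Example 2.19: with `X = ℕ`, `Xₙ = {0, …, n}`, `L = {∅, ℕ} ∪ {Xₙ}` and
`ρ(∅) = 0`, `ρ(ℕ) = 1`, `ρ(Xₙ) = 1/2`: (a) `L` is a lattice and `ρ` is a normalized mean
on it; (b) every decreasing sequence in `L` with empty intersection is eventually `∅`;
(c) any finitely additive non-negative extension `ν` of `ρ` to the Boolean algebra
generated by `L` has `ν(ℕ \ Xₙ) = 1/2` for all `n`, although `ℕ \ Xₙ` decrease with empty
intersection, so `ν` is not continuous at `∅` (hence not a pre-measure). -/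
theorem mean_not_extending_to_premeasure (L : Set (Set ℕ))
    (hLdef : L = {∅, Set.univ} ∪ {Y : Set ℕ | ∃ n : ℕ, Y = Set.Iic n})
    (ρ : Set ℕ → ℝ)
    (hρempty : ρ ∅ = 0) (hρuniv : ρ Set.univ = 1)
    (hρIic : ∀ n : ℕ, ρ (Set.Iic n) = 1 / 2) :
    (∅ ∈ L ∧ Set.univ ∈ L ∧ (∀ Y ∈ L, ∀ Z ∈ L, Y ∩ Z ∈ L) ∧ (∀ Y ∈ L, ∀ Z ∈ L, Y ∪ Z ∈ L) ∧
      (∀ Y ∈ L, 0 ≤ ρ Y ∧ ρ Y ≤ 1) ∧ (∀ Y ∈ L, ∀ Z ∈ L, Y ⊆ Z → ρ Y ≤ ρ Z) ∧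
      (∀ Y ∈ L, ∀ Z ∈ L, ρ (Y ∪ Z) = ρ Y + ρ Z - ρ (Y ∩ Z))) ∧
    (∀ A : ℕ → Set ℕ, (∀ i, A i ∈ L) → (∀ i, A (i + 1) ⊆ A i) → (⋂ i, A i) = ∅ →
      ∃ N : ℕ, ∀ i ≥ N, A i = ∅) ∧
    (∀ ν : Set ℕ → ℝ,
      (∀ Y, BoolGen L Y → 0 ≤ ν Y) → (∀ Y ∈ L, ν Y = ρ Y) →
      (∀ Y Z : Set ℕ, BoolGen L Y → BoolGen L Z → Y ∩ Z = ∅ → ν (Y ∪ Z) = ν Y + ν Z) →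
      ((∀ n : ℕ, ν ((Set.Iic n)ᶜ) = 1 / 2) ∧
        ¬ Filter.Tendsto (fun n : ℕ => ν ((Set.Iic n)ᶜ)) Filter.atTop (nhds 0))) ∧
    ((∀ n : ℕ, ((Set.Iic (n + 1) : Set ℕ)ᶜ) ⊆ ((Set.Iic n : Set ℕ)ᶜ)) ∧
      (⋂ n : ℕ, ((Set.Iic n : Set ℕ)ᶜ)) = ∅) := by
  have mem_iff : ∀ Y, Y ∈ L ↔ Y = ∅ ∨ Y = Set.univ ∨ ∃ n : ℕ, Y = Set.Iic n := by
    intro Y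
    simp [hLdef, or_assoc]
  have total : ∀ Y ∈ L, ∀ Z ∈ L, Y ⊆ Z ∨ Z ⊆ Y := fun Y hY Z hZ =>
    subset_total_of_mem_chain ((mem_iff Y).1 hY) ((mem_iff Z).1 hZ)
  have empty_mem : ∅ ∈ L := (mem_iff _).2 (.inl rfl)
  have univ_mem : Set.univ ∈ L := (mem_iff _).2 (.inr (.inl rfl))
  have Iic_mem : ∀ n : ℕ, Set.Iic n ∈ L := fun n => (mem_iff _).2 (.inr (.inr ⟨n, rfl⟩))
  refine ⟨⟨empty_mem, univ_mem, ?_, ?_, ?_, ?_, ?_⟩, ?_, ?_, ?_, ?_⟩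
  · intro Y hY Z hZ
    rcases total Y hY Z hZ with h | h
    · rwa [Set.inter_eq_left.2 h]
    · rwa [Set.inter_eq_right.2 h]
  · intro Y hY Z hZ
    rcases total Y hY Z hZ with h | h
    · rwa [Set.union_eq_right.2 h]
    · rwa [Set.union_eq_left.2 h]
  · intro Y hY
    rcases (mem_iff Y).1 hY with rfl | rfl | ⟨n, rfl⟩
    · norm_num [hρempty]
    · norm_num [hρuniv]
    · norm_num [hρIic]
  · intro Y hY Z hZ hYZ
    rcases (mem_iff Y).1 hY with rfl | rfl | ⟨m, rfl⟩
    · rcases (mem_iff Z).1 hZ with rfl | rfl | ⟨n, rfl⟩ <;> norm_num [hρempty, hρuniv, hρIic]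
    · rw [Set.univ_subset_iff.1 hYZ]
    · rcases (mem_iff Z).1 hZ with rfl | rfl | ⟨n, rfl⟩
      · rw [Set.subset_empty_iff.1 hYZ]
      · norm_num [hρuniv, hρIic]
      · rw [hρIic, hρIic]
  · intro Y hY Z hZ
    rcases total Y hY Z hZ with h | h
    · rw [Set.union_eq_right.2 h, Set.inter_eq_left.2 h]
      ring
    · rw [Set.union_eq_left.2 h, Set.inter_eq_right.2 h]
      ring
  · intro A hA hdec hinter
    have zero_mem : ∀ Y ∈ L, Y ≠ ∅ → 0 ∈ Y := by
      intro Y hY hne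
      rcases (mem_iff Y).1 hY with rfl | rfl | ⟨n, rfl⟩
      · exact absurd rfl hne
      · trivial
      · exact Nat.zero_le n
    obtain ⟨N, hN⟩ : ∃ N, A N = ∅ := by
      by_contra! hne
      have h0 : 0 ∈ ⋂ i, A i :=
        Set.mem_iInter.2 fun i => zero_mem _ (hA i) (hne i).ne_empty
      simp [hinter] at h0
    exact ⟨N, fun i hi => Set.subset_empty_iff.1 (hN ▸ antitone_nat_of_succ_le hdec hi)⟩
  · intro ν _ hext hadd
    have half : ∀ n : ℕ, ν ((Set.Iic n)ᶜ) = 1 / 2 := by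
      intro n
      have hB : BoolGen L (Set.Iic n) := .base _ (Iic_mem n)
      have h := hadd _ _ hB hB.compl (Set.inter_compl_self _)
      rw [Set.union_compl_self, hext _ univ_mem, hext _ (Iic_mem n), hρuniv, hρIic] at h
      linarith
    refine ⟨half, fun h => ?_⟩
    simp only [half] at h
    have := tendsto_nhds_unique h tendsto_const_nhds
    norm_num at this
  · intro n
    exact Set.compl_subset_compl.2 (Set.Iic_subset_Iic.2 n.le_succ)
  · exact Set.eq_empty_of_forall_notMem fun n hn => Set.mem_iInter.1 hn n Set.self_mem_Iic
end
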